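/- arXiv:0811.4704 — 2 statements merged into one kernel-verified Lean document; each statement's English description precedes it below -/
import Mathlib

section
/- For every prime p and every natural number i, the integer (ip)!/(i!·(p!)^i) is congruent to 1 modulo p; that is, Nat.uniformBell i p ≡ 1 (mod p). -/
theorem choose_mul_add_sub_one_modEq_one {p : ℕ} (hp : p.Prime) (m : ℕ) :
    (m * p + p - 1).choose (p - 1) ≡ 1 [MOD p] := by
  have := Fact.mk hp
  have hlt : p - 1 < p := Nat.sub_lt hp.pos one_pos
  have h := Choose.choose_modEq_choose_mod_mul_choose_div_nat
    (n := m * p + p - 1) (k := p - 1) (p := p)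
  rwa [Nat.mod_eq_of_lt hlt, Nat.div_eq_of_lt hlt, Nat.add_sub_assoc hp.one_le,
    Nat.mul_add_mod_of_lt hlt, Nat.choose_self, Nat.choose_zero_right, ← Nat.add_sub_assoc hp.one_le] at h

/-- For every prime `p` and every natural number `i`, the integer
`(ip)!/(i!·(p!)^i) = Nat.uniformBell i p` is congruent to `1` modulo `p`. -/
theorem uniformBell_modEq_one (p : ℕ) (hp : p.Prime) (i : ℕ) :
    Nat.uniformBell i p ≡ 1 [MOD p] := by
  induction i with
  | zero => rw [Nat.uniformBell_zero_left]
  | succ m ih =>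
    rw [Nat.uniformBell_succ_left]
    exact (choose_mul_add_sub_one_modEq_one hp m).mul ih
end

section
/- Let p be a prime, let A be a commutative ring in which p = 0, let I be an ideal of A, and let γ be a divided power structure on I. Then for all a ∈ I and all natural numbers i, γ_i(γ_p(a)) = γ_{ip}(a). -/
/-- Modulo a prime `p`, the number of partitions of a set with `m * p` elements into `m` subsets
with `p` elements is `1`. -/
theorem Nat.uniformBell_prime_modEq_one {p : ℕ} (hp : p.Prime) (m : ℕ) :
    m.uniformBell p ≡ 1 [MOD p] := by
  have : Fact p.Prime := ⟨hp⟩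
  induction m with
  | zero => rw [Nat.uniformBell_zero_left]
  | succ m ih =>
    have hlt : p - 1 < p := Nat.sub_lt hp.pos one_pos
    have hmod : (m * p + p - 1) % p = p - 1 := by
      rw [Nat.add_sub_assoc hp.one_le, Nat.mul_add_mod_self_right, Nat.mod_eq_of_lt hlt]
    have hchoose : (m * p + p - 1).choose (p - 1) ≡ 1 [MOD p] := by
      simpa [hmod, Nat.mod_eq_of_lt hlt, Nat.div_eq_of_lt hlt] using
        Choose.choose_modEq_choose_mod_mul_choose_div_nat (p := p)
          (n := m * p + p - 1) (k := p - 1)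
    rw [Nat.uniformBell_succ_left]
    exact hchoose.mul ih

/-- If `p` is a prime, `A` a commutative ring with `p = 0` in `A`, `I` an ideal of `A`
and `γ` a divided power structure on `I`, then `γ_i(γ_p(a)) = γ_{ip}(a)` for all `a ∈ I`
and all natural numbers `i`. -/
theorem dpow_dpow_prime {A : Type*} [CommRing A] {p : ℕ} (hp : p.Prime)
    (hpA : (p : A) = 0) {I : Ideal A} (γ : DividedPowers I) (i : ℕ)
    {a : A} (ha : a ∈ I) :
    γ.dpow i (γ.dpow p a) = γ.dpow (i * p) a := by
  have h := Nat.uniformBell_prime_modEq_one hp i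
  have hcast : (i.uniformBell p : A) = 1 := by
    have h' := congrArg (Nat.cast (R := A)) (Nat.mod_add_div (i.uniformBell p) p)
    rw [h, Nat.mod_eq_of_lt hp.one_lt] at h'
    simpa [hpA] using h'.symm
  rw [γ.dpow_comp hp.ne_zero ha, hcast, one_mul]
end
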